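/- Let (N,M₀) be a safe Petri net with unfolding U and B⊆2^P reachability-closed. A doomed finite configuration C of U is minimally doomed if and only if for every event e∈crest(C), the configuration C∖{e} is free. -/

import Mathlib

/-- A net `N = (P,T,F)`: the flow relation is split into its
place-to-transition part `pt` and transition-to-place part `tp`. -/
structure Net (P T : Type) where
  pt : P → T → Prop
  tp : T → P → Prop

namespace Net

variable {P T : Type} (N : Net P T)

/-- Preset of a transition: `•t`. -/
def preT (t : T) : Set P := {p | N.pt p t}
/-- Postset of a transition: `t•`. -/
def postT (t : T) : Set P := {p | N.tp t p}
/-- Preset of a place: `•p`. -/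
def preP (p : P) : Set T := {t | N.tp t p}
/-- Postset of a place: `p•`. -/
def postP (p : P) : Set T := {t | N.pt p t}

/-- Transition `t` is enabled at marking `M` iff `•t ⊆ M`. -/
def enabled (M : Set P) (t : T) : Prop := N.preT t ⊆ M
/-- Firing `t` at `M` yields `(M \ •t) ∪ t•`. -/
def fire (M : Set P) (t : T) : Set P := (M \ N.preT t) ∪ N.postT t
/-- One firing step between markings. -/
def stepRel (M M' : Set P) : Prop := ∃ t : T, N.enabled M t ∧ M' = N.fire M t
/-- Reachability between markings (finite firing sequences). -/
def reach (M M' : Set P) : Prop := Relation.ReflTransGen N.stepRel M M'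

/-- `(N, M₀)` is safe. -/
def safe (M₀ : Set P) : Prop :=
  ∀ M : Set P, N.reach M₀ M → ∀ t : T, N.enabled M t → M ∩ N.postT t ⊆ N.preT t

/-- `FiringSeq M l M'`: the sequence `l` of transitions can fire from `M`, ending in `M'`. -/
inductive FiringSeq : Set P → List T → Set P → Prop
  | nil (M : Set P) : FiringSeq M [] M
  | cons {M : Set P} (t : T) {l : List T} {M' : Set P} :
      N.enabled M t → FiringSeq (N.fire M t) l M' → FiringSeq M (t :: l) M'

/-- The underlying edge relation of the flow, on nodes `P ⊕ T`. -/
def edge : (P ⊕ T) → (P ⊕ T) → Prop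
  | Sum.inl p, Sum.inr t => N.pt p t
  | Sum.inr t, Sum.inl p => N.tp t p
  | _, _ => False

/-- Causality: `x < y` via a nonempty directed path. -/
def ltN (x y : P ⊕ T) : Prop := Relation.TransGen N.edge x y
/-- `x ≤ y` iff `x < y` or `x = y`. -/
def leN (x y : P ⊕ T) : Prop := N.ltN x y ∨ x = y

/-- Direct conflict of transitions: `•u ∩ •v ≠ ∅`. -/
def dirConflict (u v : T) : Prop := (N.preT u ∩ N.preT v).Nonempty
/-- Conflict of nodes `x # y`. -/
def conflict (x y : P ⊕ T) : Prop :=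
  ∃ u v : T, u ≠ v ∧ N.leN (Sum.inr u) x ∧ N.leN (Sum.inr v) y ∧ N.dirConflict u v
/-- Concurrency of nodes. -/
def concurrent (x y : P ⊕ T) : Prop :=
  ¬ N.leN x y ∧ ¬ N.leN y x ∧ ¬ N.conflict x y
/-- A co-set: a set of pairwise concurrent places (conditions). -/
def coset (S : Set P) : Prop :=
  ∀ b ∈ S, ∀ b' ∈ S, b ≠ b' → N.concurrent (Sum.inl b) (Sum.inl b')

end Net

/-- An occurrence net `O = (B, E, F, c₀)`: conditions `B`, events `E`. -/
structure OccNet (B E : Type) extends Net B E where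
  c₀ : Set B
  lt_irrefl : ∀ x : B ⊕ E, ¬ toNet.ltN x x
  pre_subsingleton : ∀ b : B, (toNet.preP b).Subsingleton
  mem_c₀_iff : ∀ b : B, b ∈ c₀ ↔ toNet.preP b = ∅
  no_self_conflict : ∀ e : E, ¬ toNet.conflict (Sum.inr e) (Sum.inr e)
  finite_past : ∀ e : E, {x : B ⊕ E | toNet.leN x (Sum.inr e)}.Finite

namespace OccNet

variable {B E : Type} (O : OccNet B E)

/-- A configuration: a causally closed, conflict-free set of events. -/
def config (C : Set E) : Prop :=
  (∀ e ∈ C, ∀ e' : E, O.toNet.ltN (Sum.inr e') (Sum.inr e) → e' ∈ C) ∧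
  (∀ e ∈ C, ∀ e' ∈ C, ¬ O.toNet.conflict (Sum.inr e) (Sum.inr e'))

/-- A run: a `⊆`-maximal configuration. -/
def run (ω : Set E) : Prop :=
  O.config ω ∧ ∀ C : Set E, O.config C → ω ⊆ C → C = ω

/-- `cut C = (c₀ ∪ C•) \ •C`. -/
def cut (C : Set E) : Set B :=
  (O.c₀ ∪ {b | ∃ e ∈ C, O.toNet.tp e b}) \ {b | ∃ e ∈ C, O.toNet.pt b e}

/-- Event `e` is enabled by configuration `C`. -/
def enabledBy (C : Set E) (e : E) : Prop := e ∉ C ∧ O.config (C ∪ {e})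

/-- `crest C`: the `<`-maximal events of `C`. -/
def crest (C : Set E) : Set E :=
  {e | e ∈ C ∧ ¬ ∃ e' ∈ C, O.toNet.ltN (Sum.inr e) (Sum.inr e')}

/-- The stump `⌊e⌋ = {e' : e' < e}` of an event. -/
def stump (e : E) : Set E := {e' | O.toNet.ltN (Sum.inr e') (Sum.inr e)}

/-- `spoiler e e'`: `e'` is a spoiler of `e`, i.e. `•e' ∩ •e ≠ ∅`. -/
def spoiler (e e' : E) : Prop := (O.toNet.preT e' ∩ O.toNet.preT e).Nonempty

/-- An event is unchallenged iff no other event shares a precondition with it. -/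
def unchallenged (e : E) : Prop :=
  ¬ ∃ e' : E, e' ≠ e ∧ (O.toNet.preT e' ∩ O.toNet.preT e).Nonempty

/-- A configuration is shaved iff its crest contains no unchallenged event. -/
def shaved (C : Set E) : Prop := ∀ e ∈ O.crest C, ¬ O.unchallenged e

/-- Strict `C`-conflict `e #^C e'`: `e ≠ e'`, `•e ∩ •e' ≠ ∅`, and `⌊e'⌋ ⊆ C`. -/
def strictConflict (C : Set E) (e e' : E) : Prop :=
  e ≠ e' ∧ (O.toNet.preT e ∩ O.toNet.preT e').Nonempty ∧ O.stump e' ⊆ C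

/-- Decisional height `δ(C)`: the number of events of `C` in strict `C`-conflict
with some event. -/
noncomputable def dHeight (C : Set E) : ℕ :=
  {e | e ∈ C ∧ ∃ e' : E, O.strictConflict C e e'}.ncard

end OccNet

/-- The unfolding `U = U(N, M₀)` of a Petri net `(N, M₀)`: an occurrence net with
conditions `B` and events `E`, together with the folding map (`fB` on conditions,
`fE` on events), satisfying the defining properties of the inductive construction:
the initial cut corresponds bijectively to `M₀`; the preset of an event `e` is a
co-set folded bijectively onto `•f(e)` and its postset is folded bijectively onto
`f(e)•`; events are uniquely determined by (preset, label) and exist for every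
co-set folding onto some `•t`; conditions are uniquely determined by
(producing event, label). -/
structure Unfolding (P T : Type) (N : Net P T) (M₀ : Set P) (B E : Type) where
  occ : OccNet B E
  fB : B → P
  fE : E → T
  init_bij : Set.BijOn fB occ.c₀ M₀
  pre_coset : ∀ e : E, occ.toNet.coset (occ.toNet.preT e)
  pre_bij : ∀ e : E, Set.BijOn fB (occ.toNet.preT e) (N.preT (fE e))
  post_bij : ∀ e : E, Set.BijOn fB (occ.toNet.postT e) (N.postT (fE e))
  event_unique : ∀ e e' : E,
    occ.toNet.preT e = occ.toNet.preT e' → fE e = fE e' → e = e'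
  event_exists : ∀ (S : Set B) (t : T), occ.toNet.coset S → Set.BijOn fB S (N.preT t) →
    ∃ e : E, occ.toNet.preT e = S ∧ fE e = t
  cond_unique : ∀ b b' : B,
    occ.toNet.preP b = occ.toNet.preP b' → fB b = fB b' → b = b'

/-- `Bad` is reachability-closed: `M ∈ Bad` and `M → M'` imply `M' ∈ Bad`. -/
def ReachClosed {P T : Type} (N : Net P T) (Bad : Set (Set P)) : Prop :=
  ∀ M ∈ Bad, ∀ M' : Set P, N.reach M M' → M' ∈ Bad

namespace Unfolding

variable {P T B E : Type} {N : Net P T} {M₀ : Set P} (U : Unfolding P T N M₀ B E)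

/-- `Mark C = f(cut C)`. -/
def Mark (C : Set E) : Set P := U.fB '' U.occ.cut C

/-- A finite configuration is doomed iff every run extending it contains a finite
configuration (extending it) whose marking is bad. -/
def doomed (Bad : Set (Set P)) (C : Set E) : Prop :=
  ∀ ω : Set E, U.occ.run ω → C ⊆ ω →
    ∃ C' : Set E, C'.Finite ∧ U.occ.config C' ∧ C ⊆ C' ∧ C' ⊆ ω ∧ U.Mark C' ∈ Bad

/-- A configuration is free iff it is not doomed. -/
def free (Bad : Set (Set P)) (C : Set E) : Prop := ¬ U.doomed Bad C

/-- A finite configuration is minimally doomed iff it is doomed and no proper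
sub-configuration of it is doomed. -/
def minDoomed (Bad : Set (Set P)) (C : Set E) : Prop :=
  C.Finite ∧ U.occ.config C ∧ U.doomed Bad C ∧
  ∀ C' : Set E, C' ⊂ C → U.occ.config C' → ¬ U.doomed Bad C'

/-- A (finite) prefix of the unfolding: a finite, causally closed set of events. -/
def isPrefix (E' : Set E) : Prop :=
  E'.Finite ∧ ∀ e ∈ E', ∀ e' : E, U.occ.toNet.ltN (Sum.inr e') (Sum.inr e) → e' ∈ E'

/-- A complete prefix `Π₀` of the unfolding. -/
def isCompletePrefix (E' : Set E) : Prop :=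
  U.isPrefix E' ∧
  ∀ M : Set P, N.reach M₀ M →
    ∃ C : Set E, U.occ.config C ∧ C ⊆ E' ∧ U.Mark C = M ∧
      ∀ t : T, N.enabled M t → ∃ e ∈ E', U.fE e = t ∧ U.occ.enabledBy C e

/-- `isPi1 E₀ E₁`: `E₀` is a complete prefix `Π₀` and `E₁` is the prefix `Π₁`
obtained by appending, after every `⊆`-maximal configuration `Cm` of `Π₀`, a
complete prefix of the unfolding of `(N, Mark Cm)`. -/
def isPi1 (E₀ E₁ : Set E) : Prop :=
  U.isCompletePrefix E₀ ∧ U.isPrefix E₁ ∧ E₀ ⊆ E₁ ∧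
  ∀ Cm : Set E, U.occ.config Cm → Cm ⊆ E₀ →
    (∀ C' : Set E, U.occ.config C' → C' ⊆ E₀ → Cm ⊆ C' → C' = Cm) →
    ∀ M : Set P, N.reach (U.Mark Cm) M →
      ∃ C : Set E, U.occ.config C ∧ Cm ⊆ C ∧ C ⊆ E₁ ∧ U.Mark C = M ∧
        ∀ t : T, N.enabled M t → ∃ e ∈ E₁, U.fE e = t ∧ U.occ.enabledBy C e

end Unfolding

namespace OccNet

variable {B E : Type} {O : OccNet B E}

theorem exists_mem_crest_notMem {A D : Set E} (hD : D.Finite) (hA : O.config A) (h : A ⊂ D) :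
    ∃ e ∈ O.crest D, e ∉ A := by
  let r : E → E → Prop := fun a b => O.toNet.ltN (Sum.inr b) (Sum.inr a)
  have hr : IsStrictOrder E r :=
    { irrefl := fun a => O.lt_irrefl _
      trans := fun _ _ _ hab hbc => Relation.TransGen.trans hbc hab }
  have hwf : (D \ A).WellFoundedOn r := hD.sdiff.wellFoundedOn
  obtain ⟨x, hxD, hxA⟩ := Set.exists_of_ssubset h
  obtain ⟨⟨e, heD, heA⟩, -, hmax⟩ := hwf.has_min Set.univ ⟨⟨x, hxD, hxA⟩, trivial⟩
  refine ⟨e, ⟨heD, ?_⟩, heA⟩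
  rintro ⟨e', he', hlt⟩
  exact hmax ⟨e', he', fun h' => heA (hA.1 e' h' e hlt)⟩ trivial hlt

theorem config.diff_crest {C : Set E} (hC : O.config C) {e : E} (he : e ∈ O.crest C) :
    O.config (C \ {e}) :=
  ⟨fun a ha b hb => ⟨hC.1 a ha.1 b hb, by rintro rfl; exact he.2 ⟨a, ha.1, hb⟩⟩,
    fun a ha b hb => hC.2 a ha.1 b hb.1⟩

theorem config.union {A D ω : Set E} (hω : O.config ω) (hA : O.config A) (hD : O.config D)
    (hAω : A ⊆ ω) (hDω : D ⊆ ω) : O.config (A ∪ D) :=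
  ⟨fun a ha b hb => ha.imp (fun h => hA.1 a h b hb) (fun h => hD.1 a h b hb),
    fun a ha b hb => hω.2 a (Set.union_subset hAω hDω ha) b (Set.union_subset hAω hDω hb)⟩

theorem preT_subset_cut {D : Set E} {e : E} (heD : e ∉ D) (h : O.config (insert e D)) :
    O.toNet.preT e ⊆ O.cut D := by
  intro b hb
  constructor
  · rcases Set.eq_empty_or_nonempty (O.toNet.preP b) with h0 | ⟨a, ha⟩
    · exact Or.inl ((O.mem_c₀_iff b).2 h0)
    · have hlt : O.toNet.ltN (Sum.inr a) (Sum.inr e) :=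
        Relation.TransGen.tail (b := Sum.inl b) (Relation.TransGen.single ha) hb
      rcases h.1 e (Set.mem_insert e D) a hlt with rfl | haD
      · exact (O.lt_irrefl _ hlt).elim
      · exact Or.inr ⟨a, haD, ha⟩
  · rintro ⟨a, haD, ha⟩
    exact h.2 a (Or.inr haD) e (Or.inl rfl)
      ⟨a, e, by rintro rfl; exact heD haD, Or.inr rfl, Or.inr rfl, b, ha, hb⟩

theorem cut_insert {D : Set E} {e : E} (heD : e ∉ D) (hD : O.config D) :
    O.cut (insert e D) = (O.cut D \ O.toNet.preT e) ∪ O.toNet.postT e := by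
  ext b
  constructor
  · rintro ⟨hb | ⟨a, rfl | ha, hb⟩, hn⟩
    · exact Or.inl ⟨⟨Or.inl hb, fun ⟨c, hc, h⟩ => hn ⟨c, Or.inr hc, h⟩⟩,
        fun h => hn ⟨e, Or.inl rfl, h⟩⟩
    · exact Or.inr hb
    · exact Or.inl ⟨⟨Or.inr ⟨a, ha, hb⟩, fun ⟨c, hc, h⟩ => hn ⟨c, Or.inr hc, h⟩⟩,
        fun h => hn ⟨e, Or.inl rfl, h⟩⟩
  · rintro (⟨⟨hb, hn⟩, he⟩ | hb)
    · refine ⟨hb.imp id fun ⟨a, ha, h⟩ => ⟨a, Or.inr ha, h⟩, ?_⟩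
      rintro ⟨c, rfl | hc, h⟩
      · exact he h
      · exact hn ⟨c, hc, h⟩
    · refine ⟨Or.inr ⟨e, Or.inl rfl, hb⟩, ?_⟩
      rintro ⟨c, hc, h⟩
      have hlt : O.toNet.ltN (Sum.inr e) (Sum.inr c) :=
        Relation.TransGen.tail (b := Sum.inl b) (Relation.TransGen.single hb) h
      rcases hc with rfl | hc
      · exact O.lt_irrefl _ hlt
      · exact heD (hD.1 c hc e hlt)

end OccNet

namespace Unfolding

variable {P T B E : Type} {N : Net P T} {M₀ : Set P} {U : Unfolding P T N M₀ B E}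

theorem enabled_Mark {D : Set E} {e : E} (heD : e ∉ D) (h : U.occ.config (insert e D)) :
    N.enabled (U.Mark D) (U.fE e) := by
  rw [Net.enabled, ← (U.pre_bij e).image_eq]
  exact Set.image_mono (OccNet.preT_subset_cut heD h)

theorem Mark_insert {D : Set E} {e : E} (heD : e ∉ D) (hD : U.occ.config D)
    (h : U.occ.config (insert e D)) (hinj : Set.InjOn U.fB (U.occ.cut D)) :
    U.Mark (insert e D) = N.fire (U.Mark D) (U.fE e) := by
  rw [Mark, OccNet.cut_insert heD hD, Set.image_union, (U.post_bij e).image_eq,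
    hinj.image_sdiff_subset (OccNet.preT_subset_cut heD h), (U.pre_bij e).image_eq]
  rfl

theorem injOn_cut_insert (hsafe : N.safe M₀) {D : Set E} {e : E} (heD : e ∉ D)
    (hD : U.occ.config D) (h : U.occ.config (insert e D))
    (hinj : Set.InjOn U.fB (U.occ.cut D)) (hreach : N.reach M₀ (U.Mark D)) :
    Set.InjOn U.fB (U.occ.cut (insert e D)) := by
  have key : ∀ b ∈ U.occ.cut D \ U.occ.toNet.preT e, ∀ b' ∈ U.occ.toNet.postT e,
      U.fB b ≠ U.fB b' := by
    intro b hb b' hb' hbb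
    have hmem : U.fB b ∈ N.preT (U.fE e) :=
      hsafe _ hreach _ (enabled_Mark heD h)
        ⟨Set.mem_image_of_mem _ hb.1, hbb ▸ (U.post_bij e).mapsTo hb'⟩
    obtain ⟨c, hc, hcb⟩ := (U.pre_bij e).surjOn hmem
    exact hb.2 (hinj (OccNet.preT_subset_cut heD h hc) hb.1 hcb ▸ hc)
  rw [OccNet.cut_insert heD hD]
  rintro b (hb | hb) b' (hb' | hb') hbb
  · exact hinj hb.1 hb'.1 hbb
  · exact (key b hb b' hb' hbb).elim
  · exact (key b' hb' b hb hbb.symm).elim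
  · exact (U.post_bij e).injOn hb hb' hbb

theorem injOn_cut_and_reach_Mark_of_subset (hsafe : N.safe M₀) {A : Set E} (hA : U.occ.config A)
    (hinj : Set.InjOn U.fB (U.occ.cut A)) (hreach : N.reach M₀ (U.Mark A))
    {D : Set E} (hfin : D.Finite) (hD : U.occ.config D) (hAD : A ⊆ D) :
    Set.InjOn U.fB (U.occ.cut D) ∧ N.reach (U.Mark A) (U.Mark D) := by
  induction hn : D.ncard using Nat.strong_induction_on generalizing D with
  | _ n ih =>
    rcases hAD.eq_or_ssubset with rfl | hss
    · exact ⟨hinj, Relation.ReflTransGen.refl⟩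
    · obtain ⟨e, he, heA⟩ := OccNet.exists_mem_crest_notMem hfin hA hss
      have hD' := hD.diff_crest he
      have hins : insert e (D \ {e}) = D := Set.insert_sdiff_self_of_mem he.1
      have hne : e ∉ D \ {e} := fun h => h.2 rfl
      obtain ⟨hinj', hreach'⟩ := ih (D \ {e}).ncard
        (hn ▸ Set.ncard_sdiff_singleton_lt_of_mem he.1 hfin) hfin.sdiff hD'
        (Set.subset_sdiff_singleton hAD heA) rfl
      have h1 := injOn_cut_insert hsafe hne hD' (hins.symm ▸ hD) hinj' (hreach.trans hreach')
      have h2 := Mark_insert hne hD' (hins.symm ▸ hD) hinj'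
      have h3 := enabled_Mark hne (hins.symm ▸ hD)
      rw [hins] at h1 h2
      exact ⟨h1, hreach'.tail ⟨U.fE e, h3, h2⟩⟩

theorem reach_Mark_of_subset (hsafe : N.safe M₀) {A D : Set E} (hA : U.occ.config A)
    (hfin : D.Finite) (hD : U.occ.config D) (hAD : A ⊆ D) :
    N.reach (U.Mark A) (U.Mark D) := by
  have hcut : U.occ.cut ∅ = U.occ.c₀ := by simp [OccNet.cut]
  have hM : U.Mark ∅ = M₀ := by rw [Mark, hcut, U.init_bij.image_eq]
  obtain ⟨hinj, hreach⟩ := injOn_cut_and_reach_Mark_of_subset (U := U) hsafe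
    (A := ∅) ⟨fun _ h => h.elim, fun _ h => h.elim⟩ (by rw [hcut]; exact U.init_bij.injOn)
    (by rw [hM]; exact Relation.ReflTransGen.refl) (hfin.subset hAD) hA (Set.empty_subset A)
  rw [hM] at hreach
  exact (injOn_cut_and_reach_Mark_of_subset hsafe hA hinj hreach hfin hD hAD).2

/-- Doom is inherited by larger finite configurations. -/
theorem doomed.mono (hsafe : N.safe M₀) {Bad : Set (Set P)} (hBad : ReachClosed N Bad)
    {A D : Set E} (hA : U.doomed Bad A) (hfin : D.Finite) (hD : U.occ.config D) (hAD : A ⊆ D) :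
    U.doomed Bad D := by
  intro ω hω hDω
  obtain ⟨A', hA'fin, hA', -, hA'ω, hbad⟩ := hA ω hω (hAD.trans hDω)
  have hconf := hω.1.union hA' hD hA'ω hDω
  exact ⟨A' ∪ D, hA'fin.union hfin, hconf, Set.subset_union_right, Set.union_subset hA'ω hDω,
    hBad _ hbad _ (reach_Mark_of_subset hsafe hA' (hA'fin.union hfin) hconf
      Set.subset_union_left)⟩

end Unfolding

/-- a doomed finite configuration `C` of the unfolding is
minimally doomed iff `C \ {e}` is free for every crest event `e` of `C`. -/
theorem minDoomed_iff_crest_rub_free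
    {P T B E : Type} [Finite P] [Finite T]
    (N : Net P T) (M₀ : Set P) (hsafe : N.safe M₀)
    (U : Unfolding P T N M₀ B E)
    (Bad : Set (Set P)) (hBad : ReachClosed N Bad)
    (C : Set E) (hfin : C.Finite) (hC : U.occ.config C)
    (hdoomed : U.doomed Bad C) :
    U.minDoomed Bad C ↔ ∀ e ∈ U.occ.crest C, U.free Bad (C \ {e}) := by
  constructor
  · rintro ⟨-, -, -, hmin⟩ e he
    exact hmin _ (Set.sdiff_singleton_ssubset.2 he.1) (hC.diff_crest he)
  · intro h
    refine ⟨hfin, hC, hdoomed, fun C' hss hC' hdoom => ?_⟩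
    obtain ⟨e, he, heC'⟩ := OccNet.exists_mem_crest_notMem hfin hC' hss
    exact h e he (hdoom.mono hsafe hBad hfin.sdiff (hC.diff_crest he)
      (Set.subset_sdiff_singleton hss.subset heC'))
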